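/- arXiv:math/0408200 — 2 statements merged into one kernel-verified Lean document; each statement's English description precedes it below -/
import Mathlib

section
/- There exist a compact metric space X that is zero-dimensional (totally disconnected) and a closed subset S ⊆ X such that there is no continuous linear operator extending Lipschitz metrics: no map u : M_Lip(S) → M_Lip(X) which is additive and positively homogeneous, satisfies u(ρ)|_{S×S} = ρ for every ρ ∈ M_Lip(S), and has finite norm ‖u‖ = sup{‖u(ρ)‖_X : ρ ∈ M_Lip(S), ‖ρ‖_S ≤ 1}. -/
open Set

section Defs

variable {X : Type*}

/-- `ρ` is a pseudometric on the subset `A`: nonnegative, symmetric,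
vanishing on the diagonal, and satisfying the triangle inequality on `A`. -/
def IsPseudometricOn (A : Set X) (ρ : X → X → ℝ) : Prop :=
  (∀ x ∈ A, ∀ y ∈ A, 0 ≤ ρ x y) ∧
  (∀ x ∈ A, ∀ y ∈ A, ρ x y = ρ y x) ∧
  (∀ x ∈ A, ρ x x = 0) ∧
  (∀ x ∈ A, ∀ y ∈ A, ∀ z ∈ A, ρ x z ≤ ρ x y + ρ y z)

/-- `ρ x y ≤ M * d x y` on `A`; for a Lipschitz pseudometric this says `‖ρ‖_A ≤ M`. -/
def PMNormLE (d : X → X → ℝ) (A : Set X) (ρ : X → X → ℝ) (M : ℝ) : Prop :=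
  ∀ x ∈ A, ∀ y ∈ A, ρ x y ≤ M * d x y

/-- `ρ` is a Lipschitz pseudometric on `A` with respect to the distance `d`. -/
def IsLipPM (d : X → X → ℝ) (A : Set X) (ρ : X → X → ℝ) : Prop :=
  IsPseudometricOn A ρ ∧ ∃ C > 0, PMNormLE d A ρ C

/-- `ρ` is a Lipschitz metric on `A` with respect to the distance `d`. -/
def IsLipM (d : X → X → ℝ) (A : Set X) (ρ : X → X → ℝ) : Prop :=
  IsLipPM d A ρ ∧ ∀ x ∈ A, ∀ y ∈ A, x ≠ y → 0 < ρ x y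

/-- `u` is an extension operator for Lipschitz pseudometrics from `A` to `B`:
it maps Lipschitz pseudometrics on `A` to Lipschitz pseudometrics on `B`,
is additive and positively homogeneous, and `u ρ` restricts to `ρ` on `A × A`. -/
def IsPMExtOp (d : X → X → ℝ) (A B : Set X) (u : (X → X → ℝ) → X → X → ℝ) : Prop :=
  (∀ ρ, IsLipPM d A ρ → IsLipPM d B (u ρ)) ∧
  (∀ ρ₁ ρ₂, IsLipPM d A ρ₁ → IsLipPM d A ρ₂ →
    u (fun x y => ρ₁ x y + ρ₂ x y) = fun x y => u ρ₁ x y + u ρ₂ x y) ∧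
  (∀ c : ℝ, 0 ≤ c → ∀ ρ, IsLipPM d A ρ →
    u (fun x y => c * ρ x y) = fun x y => c * u ρ x y) ∧
  (∀ ρ, IsLipPM d A ρ → ∀ x ∈ A, ∀ y ∈ A, u ρ x y = ρ x y)

/-- `‖u‖ ≤ M` for an operator on Lipschitz pseudometrics:
`‖ρ‖_A ≤ 1` implies `‖u ρ‖_B ≤ M`. -/
def PMOpNormLE (d : X → X → ℝ) (A B : Set X) (u : (X → X → ℝ) → X → X → ℝ) (M : ℝ) : Prop :=
  ∀ ρ, IsLipPM d A ρ → PMNormLE d A ρ 1 → PMNormLE d B (u ρ) M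

/-- `u` is an extension operator for Lipschitz metrics from `A` to `B`. -/
def IsMExtOp (d : X → X → ℝ) (A B : Set X) (u : (X → X → ℝ) → X → X → ℝ) : Prop :=
  (∀ ρ, IsLipM d A ρ → IsLipM d B (u ρ)) ∧
  (∀ ρ₁ ρ₂, IsLipM d A ρ₁ → IsLipM d A ρ₂ →
    u (fun x y => ρ₁ x y + ρ₂ x y) = fun x y => u ρ₁ x y + u ρ₂ x y) ∧
  (∀ c : ℝ, 0 < c → ∀ ρ, IsLipM d A ρ →
    u (fun x y => c * ρ x y) = fun x y => c * u ρ x y) ∧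
  (∀ ρ, IsLipM d A ρ → ∀ x ∈ A, ∀ y ∈ A, u ρ x y = ρ x y)

/-- `‖u‖ ≤ M` for an operator on Lipschitz metrics. -/
def MOpNormLE (d : X → X → ℝ) (A B : Set X) (u : (X → X → ℝ) → X → X → ℝ) (M : ℝ) : Prop :=
  ∀ ρ, IsLipM d A ρ → PMNormLE d A ρ 1 → PMNormLE d B (u ρ) M

/-- `|f x - f y| ≤ M * d x y` on `A`; i.e. the Lipschitz seminorm `‖f‖_A ≤ M`. -/
def FunNormLE (d : X → X → ℝ) (A : Set X) (f : X → ℝ) (M : ℝ) : Prop :=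
  ∀ x ∈ A, ∀ y ∈ A, |f x - f y| ≤ M * d x y

/-- `f` is Lipschitz on `A` with respect to the distance `d`. -/
def IsLipFun (d : X → X → ℝ) (A : Set X) (f : X → ℝ) : Prop :=
  ∃ C > 0, FunNormLE d A f C

/-- `v` is a linear extension operator for Lipschitz functions from `A` to `B`. -/
def IsFunExtOp (d : X → X → ℝ) (A B : Set X) (v : (X → ℝ) → X → ℝ) : Prop :=
  (∀ f, IsLipFun d A f → IsLipFun d B (v f)) ∧
  (∀ f g, IsLipFun d A f → IsLipFun d A g →
    v (fun x => f x + g x) = fun x => v f x + v g x) ∧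
  (∀ c : ℝ, ∀ f, IsLipFun d A f → v (fun x => c * f x) = fun x => c * v f x) ∧
  (∀ f, IsLipFun d A f → ∀ x ∈ A, v f x = f x)

/-- `‖v‖ ≤ M` for an operator on Lipschitz functions. -/
def FunOpNormLE (d : X → X → ℝ) (A B : Set X) (v : (X → ℝ) → X → ℝ) (M : ℝ) : Prop :=
  ∀ f, IsLipFun d A f → FunNormLE d A f 1 → FunNormLE d B (v f) M

/-- `λ(A, B)`: the infimum of the norms of linear extension operators for Lipschitz
functions from `A` to `B` (`⊤` if there is none). -/
noncomputable def lambdaFun (d : X → X → ℝ) (A B : Set X) : ENNReal :=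
  sInf {L : ENNReal | ∃ M : ℝ, L = ENNReal.ofReal M ∧
    ∃ v, IsFunExtOp d A B v ∧ FunOpNormLE d A B v M}

end Defs

/-- If `u` has norm at most `M`, then it increases the norm of any Lipschitz metric at most
`M`-fold. -/
lemma MOpNormLE.pmNormLE {X : Type*} [PseudoMetricSpace X] {S : Set X}
    {u : (X → X → ℝ) → X → X → ℝ} {M t : ℝ} (hu : IsMExtOp dist S univ u)
    (hM : MOpNormLE dist S univ u M) {ρ : X → X → ℝ} (hρ : IsLipM dist S ρ) (ht : 0 < t)
    (hle : PMNormLE dist S ρ t) : PMNormLE dist univ (u ρ) (t * M) := by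
  obtain ⟨⟨⟨h0, hs, hd, htri⟩, C, hC, hCle⟩, hpos⟩ := hρ
  have ht' : 0 < t⁻¹ := inv_pos.2 ht
  have hle' : PMNormLE dist S (fun x y => t⁻¹ * ρ x y) 1 := fun x hx y hy => by
    rw [one_mul, inv_mul_le_iff₀ ht]
    exact hle x hx y hy
  have hmet : IsLipM dist S (fun x y => t⁻¹ * ρ x y) := by
    refine ⟨⟨⟨fun x hx y hy => mul_nonneg ht'.le (h0 x hx y hy),
      fun x hx y hy => congrArg (t⁻¹ * ·) (hs x hx y hy), fun x hx => by simp [hd x hx],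
      fun x hx y hy z hz => ?_⟩, 1, one_pos, hle'⟩,
      fun x hx y hy hxy => mul_pos ht' (hpos x hx y hy hxy)⟩
    rw [← mul_add]
    exact mul_le_mul_of_nonneg_left (htri x hx y hy z hz) ht'.le
  intro x hx y hy
  have h1 := hM _ hmet hle' x hx y hy
  rw [hu.2.2.1 t⁻¹ ht' ρ ⟨⟨⟨h0, hs, hd, htri⟩, C, hC, hCle⟩, hpos⟩, inv_mul_le_iff₀ ht] at h1
  linarith

/-- The sum of two Lipschitz metrics is a Lipschitz metric. -/
lemma IsLipM.add {X : Type*} {d : X → X → ℝ} {S : Set X} {ρ σ : X → X → ℝ}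
    (hρ : IsLipM d S ρ) (hσ : IsLipM d S σ) : IsLipM d S (fun x y => ρ x y + σ x y) := by
  obtain ⟨⟨⟨h0, hs, hd, ht⟩, C, hC, hCle⟩, hpos⟩ := hρ
  obtain ⟨⟨⟨h0', hs', hd', ht'⟩, C', hC', hCle'⟩, hpos'⟩ := hσ
  refine ⟨⟨⟨fun x hx y hy => add_nonneg (h0 x hx y hy) (h0' x hx y hy),
    fun x hx y hy => congrArg₂ (· + ·) (hs x hx y hy) (hs' x hx y hy),
    fun x hx => by simp [hd x hx, hd' x hx],
    fun x hx y hy z hz => by linarith [ht x hx y hy z hz, ht' x hx y hy z hz]⟩,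
    C + C', add_pos hC hC', fun x hx y hy => ?_⟩,
    fun x hx y hy hxy => add_pos (hpos x hx y hy hxy) (hpos' x hx y hy hxy)⟩
  rw [add_mul]
  exact add_le_add (hCle x hx y hy) (hCle' x hx y hy)

/-- Extension operators commute with nonempty finite sums. -/
lemma IsMExtOp.map_sum {X ι : Type*} {d : X → X → ℝ} {A B : Set X}
    {u : (X → X → ℝ) → X → X → ℝ} (hu : IsMExtOp d A B u) {s : Finset ι} (hs : s.Nonempty)
    {ρ : ι → X → X → ℝ} (hρ : ∀ i, IsLipM d A (ρ i)) :
    IsLipM d A (fun x y => ∑ i ∈ s, ρ i x y) ∧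
      u (fun x y => ∑ i ∈ s, ρ i x y) = fun x y => ∑ i ∈ s, u (ρ i) x y := by
  induction hs using Finset.Nonempty.cons_induction with
  | singleton a => simpa using hρ a
  | cons a s ha hs ih =>
    simp only [Finset.sum_cons]
    exact ⟨(hρ a).add ih.1, by rw [hu.2.1 _ _ (hρ a) ih.1, ih.2]⟩

/-- The metric `r * |b x - b y| + t * dist x y` obtained from a Lipschitz function `b`. -/
lemma isLipM_abs_sub_add_dist {X : Type*} [MetricSpace X] {S : Set X} {b : X → ℝ} {r t C : ℝ}
    (hr : 0 ≤ r) (ht : 0 < t) (hC : 0 ≤ C)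
    (hb : ∀ x ∈ S, ∀ y ∈ S, r * |b x - b y| ≤ C * dist x y) :
    IsLipM dist S (fun x y => r * |b x - b y| + t * dist x y) ∧
      PMNormLE dist S (fun x y => r * |b x - b y| + t * dist x y) (C + t) := by
  have hle : PMNormLE dist S (fun x y => r * |b x - b y| + t * dist x y) (C + t) :=
    fun x hx y hy => by
      rw [add_mul]
      exact add_le_add_left (hb x hx y hy) _
  refine ⟨⟨⟨⟨fun x _ y _ => by positivity, fun x _ y _ => by simp only [abs_sub_comm, dist_comm],
    fun x _ => by simp, fun x _ y _ z _ => ?_⟩, C + t, by positivity, hle⟩,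
    fun x _ y _ hxy => ?_⟩, hle⟩
  · have h1 := mul_le_mul_of_nonneg_left (abs_sub_le (b x) (b y) (b z)) hr
    have h2 := mul_le_mul_of_nonneg_left (dist_triangle x y z) ht.le
    linarith
  · have := mul_pos ht (dist_pos.2 hxy)
    positivity

/-- Negating the `i`-th coordinate of a vertex of the discrete cube. -/
def flipCoord {k : ℕ} (i : Fin k) (x : Fin k → Bool) : Fin k → Bool :=
  Function.update x i (!x i)

lemma flipCoord_involutive {k : ℕ} (i : Fin k) : Function.Involutive (flipCoord i) := by
  intro x
  simp [flipCoord]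

/-- Suppose that `X` contains a copy `f` of the `k`-dimensional discrete cube (with edges of length
at most `r`), each of whose vertices `f x` is at distance at most `L * r` from a point `g x` of `S`.
If the coordinates of the cube extend to functions `b i` on `S` which are Lipschitz with
constant `(2 * L * r)⁻¹`, while the sum of the associated pseudometrics has norm at most `r⁻¹`, then
the norm `M` of an operator extending Lipschitz metrics from `S` to `X` satisfies
`k ≤ 4 * M * L + k * M / (2 * L) + M`. -/
lemma IsMExtOp.le_of_cube {X : Type*} [MetricSpace X] {S : Set X}
    {u : (X → X → ℝ) → X → X → ℝ} {M L r : ℝ} {k : ℕ} (hu : IsMExtOp dist S univ u)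
    (hM : MOpNormLE dist S univ u M) (hM0 : 0 ≤ M) (hL : 0 < L) (hr : 0 < r) (hk : 0 < k)
    (f g : (Fin k → Bool) → X) (b : Fin k → X → ℝ) (hg : ∀ x, g x ∈ S)
    (hb : ∀ i x, b i (g x) = if x i then 1 else 0)
    (hfg : ∀ x, dist (f x) (g x) ≤ L * r)
    (hf : ∀ i x, dist (f x) (f (flipCoord i x)) ≤ r)
    (hbL : ∀ i, ∀ p ∈ S, ∀ q ∈ S, r * |b i p - b i q| ≤ (2 * L)⁻¹ * dist p q)
    (hbsum : ∀ p ∈ S, ∀ q ∈ S, ∑ i, r * |b i p - b i q| ≤ dist p q) :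
    (k : ℝ) ≤ 4 * M * L + k * M / (2 * L) + M := by
  have hk' : (0 : ℝ) < k := Nat.cast_pos.2 hk
  set t : ℝ := (k : ℝ)⁻¹ with ht
  have ht0 : 0 < t := inv_pos.2 hk'
  have hkt : k * t = 1 := mul_inv_cancel₀ hk'.ne'
  set C : ℝ := (2 * L)⁻¹ with hC
  have hC0 : 0 < C := by positivity
  let ρ : Fin k → X → X → ℝ := fun i x y => r * |b i x - b i y| + t * dist x y
  have hρ : ∀ i, IsLipM dist S (ρ i) ∧ PMNormLE dist S (ρ i) (C + t) := fun i =>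
    isLipM_abs_sub_add_dist hr.le ht0 hC0.le (hbL i)
  have : Nonempty (Fin k) := ⟨⟨0, hk⟩⟩
  obtain ⟨hσ, hσu⟩ := hu.map_sum Finset.univ_nonempty (fun i => (hρ i).1)
  have hσle : PMNormLE dist S (fun x y => ∑ i, ρ i x y) 2 := fun x hx y hy => by
    have h1 := hbsum x hx y hy
    have h2 : ∑ i, ρ i x y = ∑ i, r * |b i x - b i y| + dist x y := by
      simp only [ρ, Finset.sum_add_distrib, Finset.sum_const, Finset.card_univ, Fintype.card_fin,
        nsmul_eq_mul]
      rw [← mul_assoc, hkt, one_mul]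
    simp only [h2]
    linarith
  have hvert : ∀ x, ∑ i, u (ρ i) (f x) (g x) ≤ 2 * M * (L * r) := fun x => by
    have h1 := hM.pmNormLE hu hσ two_pos hσle (f x) trivial (g x) trivial
    rw [hσu] at h1
    exact h1.trans (mul_le_mul_of_nonneg_left (hfg x) (by positivity))
  have hedge : ∀ i x, r ≤ u (ρ i) (f x) (g x) +
      u (ρ i) (f (flipCoord i x)) (g (flipCoord i x)) + (C + t) * M * r := fun i x => by
    obtain ⟨⟨-, hsymm, -, htri⟩, -⟩ := (hu.1 _ (hρ i).1).1
    have h1 := (hM.pmNormLE hu (hρ i).1 (by positivity) (hρ i).2 (f x) trivial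
      (f (flipCoord i x)) trivial).trans (mul_le_mul_of_nonneg_left (hf i x) (by positivity))
    have h2 : r ≤ ρ i (g x) (g (flipCoord i x)) := by
      have h3 : |b i (g x) - b i (g (flipCoord i x))| = 1 := by
        rw [hb, hb]
        cases hx : x i <;> simp [flipCoord, hx]
      simp only [ρ, h3, mul_one]
      exact le_add_of_nonneg_right (by positivity)
    rw [← hu.2.2.2 _ (hρ i).1 _ (hg _) _ (hg _)] at h2
    have h4 := htri (g x) trivial (f x) trivial (g (flipCoord i x)) trivial
    have h5 := htri (f x) trivial (f (flipCoord i x)) trivial (g (flipCoord i x)) trivial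
    rw [hsymm (g x) trivial (f x) trivial] at h4
    linarith
  have hcoord : ∀ i, (2 ^ k : ℝ) * r ≤
      2 * ∑ x, u (ρ i) (f x) (g x) + 2 ^ k * ((C + t) * M * r) := fun i => by
    have h1 := Finset.sum_le_sum (fun x (_ : x ∈ Finset.univ) => hedge i x)
    have h2 : ∑ x, u (ρ i) (f (flipCoord i x)) (g (flipCoord i x)) = ∑ x, u (ρ i) (f x) (g x) :=
      Equiv.sum_comp (flipCoord_involutive i).toPerm (fun x => u (ρ i) (f x) (g x))
    simp only [Finset.sum_add_distrib, Finset.sum_const, Finset.card_univ, Fintype.card_pi,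
      Fintype.card_bool, Finset.prod_const, Fintype.card_fin, nsmul_eq_mul, h2] at h1
    push_cast at h1
    linarith
  have hsum := Finset.sum_le_sum (fun i (_ : i ∈ Finset.univ) => hcoord i)
  have hsum' := Finset.sum_le_sum
    (fun x (_ : x ∈ (Finset.univ : Finset (Fin k → Bool))) => hvert x)
  rw [Finset.sum_comm] at hsum'
  simp only [Finset.sum_add_distrib, ← Finset.mul_sum, Finset.sum_const, Finset.card_univ,
    Fintype.card_pi, Fintype.card_bool, Finset.prod_const, Fintype.card_fin, nsmul_eq_mul]
    at hsum hsum'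
  push_cast at hsum'
  have hpow : (0 : ℝ) < 2 ^ k * r := by positivity
  refine le_of_mul_le_mul_left ?_ hpow
  have h6 : (2 : ℝ) ^ k * r * (4 * M * L + k * M / (2 * L) + M) =
      2 * (2 ^ k * (2 * M * (L * r))) + k * (2 ^ k * ((C + t) * M * r)) := by
    have : (2 : ℝ) ^ k * r * M = (k * t) * (2 ^ k * r * M) := by rw [hkt, one_mul]
    rw [mul_add _ _ M, this, hC, div_eq_mul_inv]
    ring
  linarith

/-- The distance on a disjoint union of metric spaces `B i` for which points of `B i` and of `B j`,
`i ≠ j`, are at distance `max (h i) (h j)`. -/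
noncomputable def sigmaMaxDist {ι : Type*} [DecidableEq ι] {B : ι → Type*} [∀ i, Dist (B i)]
    (h : ι → ℝ) (p q : Σ i, B i) : ℝ :=
  if e : p.1 = q.1 then dist (e ▸ p.2) q.2 else max (h p.1) (h q.1)

section SigmaMax

variable {ι : Type*} [DecidableEq ι] {B : ι → Type*} [∀ i, MetricSpace (B i)] {h : ι → ℝ}

lemma sigmaMaxDist_same (i : ι) (x y : B i) : sigmaMaxDist h ⟨i, x⟩ ⟨i, y⟩ = dist x y := by
  simp [sigmaMaxDist]

lemma sigmaMaxDist_of_ne {i j : ι} (hij : i ≠ j) (x : B i) (y : B j) :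
    sigmaMaxDist h ⟨i, x⟩ ⟨j, y⟩ = max (h i) (h j) := by
  simp [sigmaMaxDist, hij]

/-- `sigmaMaxDist h` is a metric if `h i` bounds the diameter of `B i`. -/
@[reducible]
noncomputable def sigmaMaxMetricSpace (h : ι → ℝ) (hd : ∀ i, ∀ x y : B i, dist x y ≤ h i)
    (hpos : ∀ i j, i ≠ j → 0 < max (h i) (h j)) : MetricSpace (Σ i, B i) where
  dist := sigmaMaxDist h
  dist_self := fun ⟨i, x⟩ => by
    rw [sigmaMaxDist_same, dist_self]
  dist_comm := fun ⟨i, x⟩ ⟨j, y⟩ => by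
    rcases eq_or_ne i j with rfl | hij
    · rw [sigmaMaxDist_same, sigmaMaxDist_same, dist_comm]
    · rw [sigmaMaxDist_of_ne hij, sigmaMaxDist_of_ne hij.symm, max_comm]
  dist_triangle := fun ⟨i, x⟩ ⟨j, y⟩ ⟨k, z⟩ => by
    have hi : 0 ≤ h i := dist_nonneg.trans (hd i x x)
    have hj : 0 ≤ h j := dist_nonneg.trans (hd j y y)
    have hk : 0 ≤ h k := dist_nonneg.trans (hd k z z)
    rcases eq_or_ne i j with rfl | hij
    · rcases eq_or_ne i k with rfl | hik
      · simpa only [sigmaMaxDist_same] using dist_triangle x y z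
      · rw [sigmaMaxDist_of_ne hik, sigmaMaxDist_of_ne hik, sigmaMaxDist_same]
        exact le_add_of_nonneg_left dist_nonneg
    · rcases eq_or_ne j k with rfl | hjk
      · rw [sigmaMaxDist_of_ne hij, sigmaMaxDist_of_ne hij, sigmaMaxDist_same]
        exact le_add_of_nonneg_right dist_nonneg
      · rw [sigmaMaxDist_of_ne hij, sigmaMaxDist_of_ne hjk]
        have h1 := le_max_left (h i) (h j)
        have h2 := le_max_right (h j) (h k)
        rcases eq_or_ne i k with rfl | hik
        · rw [sigmaMaxDist_same]
          linarith [hd i x z]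
        · rw [sigmaMaxDist_of_ne hik]
          exact max_le (by linarith) (by linarith)
  eq_of_dist_eq_zero := fun {p q} hpq => by
    obtain ⟨i, x⟩ := p
    obtain ⟨j, y⟩ := q
    change sigmaMaxDist h _ _ = 0 at hpq
    rcases eq_or_ne i j with rfl | hij
    · rw [sigmaMaxDist_same] at hpq
      rw [eq_of_dist_eq_zero hpq]
    · rw [sigmaMaxDist_of_ne hij] at hpq
      exact absurd hpq (hpos i j hij).ne'

end SigmaMax

/-- A space in which all neighbourhoods of some point are cofinite is compact. -/
lemma compactSpace_of_finite_compl_nhds {X : Type*} [TopologicalSpace X] (a : X)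
    (ha : ∀ s ∈ nhds a, sᶜ.Finite) : CompactSpace X := by
  refine ⟨isCompact_iff_ultrafilter_le_nhds.2 fun f _ => ?_⟩
  by_cases hf : (f : Filter X) ≤ nhds a
  · exact ⟨a, trivial, hf⟩
  · obtain ⟨s, hs, hsf⟩ := Filter.not_le.1 hf
    obtain ⟨x, -, rfl⟩ := Ultrafilter.eq_pure_of_finite_mem (ha s hs)
      (Ultrafilter.compl_mem_iff_notMem.2 hsf)
    exact ⟨x, trivial, pure_le_nhds x⟩

/-- The dimension of the discrete cube in the `n`-th block. -/
def cubeDim (n : ℕ) : ℕ := 16 * (n + 1) ^ 2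

lemma cast_cubeDim (n : ℕ) : (cubeDim n : ℝ) = 16 * ((n : ℝ) + 1) ^ 2 := by
  simp [cubeDim]

/-- The length of the edges of the discrete cube in the `n`-th block. -/
noncomputable def cubeScale (n : ℕ) : ℝ := (20 * ((n : ℝ) + 1) ^ 3)⁻¹

lemma cubeScale_pos (n : ℕ) : 0 < cubeScale n := by
  unfold cubeScale
  positivity

/-- The `n`-th block: a discrete cube, together with one terminal for each of its vertices. -/
@[ext]
structure CubeBlock (n : ℕ) where
  /-- The vertex itself, or the vertex to which the terminal belongs. -/
  vertex : Fin (cubeDim n) → Bool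
  /-- Whether the point is a terminal. -/
  isTerminal : Bool

instance (n : ℕ) : Finite (CubeBlock n) :=
  Finite.of_injective (fun p => (p.vertex, p.isTerminal)) fun _ _ h =>
    CubeBlock.ext (congrArg Prod.fst h) (congrArg Prod.snd h)

open Classical in
/-- The pseudometric of a star whose leaves are the terminals and whose centre represents all the
vertices of the cube. -/
noncomputable def starDist {n : ℕ} (p q : CubeBlock n) : ℝ :=
  if p = q then 0 else (if p.isTerminal then 1 else 0) + (if q.isTerminal then 1 else 0)

lemma starDist_nonneg {n : ℕ} (p q : CubeBlock n) : 0 ≤ starDist p q := by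
  unfold starDist
  split_ifs <;> norm_num

lemma starDist_le_two {n : ℕ} (p q : CubeBlock n) : starDist p q ≤ 2 := by
  unfold starDist
  split_ifs <;> norm_num

lemma starDist_comm {n : ℕ} (p q : CubeBlock n) : starDist p q = starDist q p := by
  rcases eq_or_ne p q with rfl | hpq
  · rfl
  · simp [starDist, hpq, hpq.symm, add_comm]

lemma starDist_triangle {n : ℕ} (p q s : CubeBlock n) :
    starDist p s ≤ starDist p q + starDist q s := by
  rcases eq_or_ne p q with rfl | hpq
  · simp [starDist]
  rcases eq_or_ne q s with rfl | hqs
  · simp [starDist]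
  unfold starDist
  rw [if_neg hpq, if_neg hqs]
  split_ifs <;> norm_num

lemma starDist_of_ne {n : ℕ} {p q : CubeBlock n} (hp : p.isTerminal = true)
    (hq : q.isTerminal = true)
    (hpq : p ≠ q) : starDist p q = 2 := by
  simp [starDist, hpq, hp, hq]
  norm_num

/-- The edges of the cube have length `cubeScale n`, and each terminal is attached to its vertex by
an edge of length `2 * (n + 1) * cubeScale n`. -/
noncomputable instance (n : ℕ) : MetricSpace (CubeBlock n) where
  dist p q := cubeScale n * (hammingDist p.vertex q.vertex + 2 * ((n : ℝ) + 1) * starDist p q)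
  dist_self p := by simp [starDist]
  dist_comm p q := by rw [hammingDist_comm, starDist_comm]
  dist_triangle p q s := by
    rw [← mul_add]
    refine mul_le_mul_of_nonneg_left ?_ (cubeScale_pos n).le
    have h1 : (hammingDist p.vertex s.vertex : ℝ) ≤
        hammingDist p.vertex q.vertex + hammingDist q.vertex s.vertex := by
      exact_mod_cast hammingDist_triangle p.vertex q.vertex s.vertex
    have h2 := mul_le_mul_of_nonneg_left (starDist_triangle p q s)
      (by positivity : 0 ≤ 2 * ((n : ℝ) + 1))
    linarith
  eq_of_dist_eq_zero := fun {p q} hpq => by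
    by_contra hne
    have hs := starDist_nonneg p q
    have h1 := (mul_eq_zero.1 hpq).resolve_left (cubeScale_pos n).ne'
    have h2 : (0 : ℝ) ≤ hammingDist p.vertex q.vertex := Nat.cast_nonneg _
    have h3 : 0 ≤ 2 * ((n : ℝ) + 1) * starDist p q := by positivity
    have h4 : (hammingDist p.vertex q.vertex : ℝ) = 0 := by linarith
    have h5 : p.vertex = q.vertex := hammingDist_eq_zero.1 (by exact_mod_cast h4)
    have h6 : starDist p q = 0 := by
      refine (mul_eq_zero.1 (by linarith : 2 * ((n : ℝ) + 1) * starDist p q = 0)).resolve_left ?_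
      positivity
    obtain ⟨x, a⟩ := p
    obtain ⟨y, c⟩ := q
    simp only at h5
    subst h5
    cases a <;> cases c <;> simp [starDist] at h6 hne

lemma CubeBlock.dist_eq {n : ℕ} (p q : CubeBlock n) :
    dist p q =
      cubeScale n * (hammingDist p.vertex q.vertex + 2 * ((n : ℝ) + 1) * starDist p q) := rfl

lemma cubeScale_mul_hammingDist_le {n : ℕ} (x y : Fin (cubeDim n) → Bool) :
    cubeScale n * hammingDist x y ≤ cubeScale n * (16 * ((n : ℝ) + 1) ^ 2) := by
  refine mul_le_mul_of_nonneg_left ?_ (cubeScale_pos n).le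
  have h1 : hammingDist x y ≤ 16 * (n + 1) ^ 2 :=
    hammingDist_le_card_fintype.trans_eq (Fintype.card_fin _)
  exact_mod_cast h1

lemma cubeScale_mul (n : ℕ) : cubeScale n * (20 * ((n : ℝ) + 1) ^ 2) = ((n : ℝ) + 1)⁻¹ := by
  unfold cubeScale
  have : (n : ℝ) + 1 ≠ 0 := by positivity
  field_simp

lemma CubeBlock.dist_le {n : ℕ} (p q : CubeBlock n) : dist p q ≤ ((n : ℝ) + 1)⁻¹ := by
  rw [CubeBlock.dist_eq, mul_add, ← cubeScale_mul]
  have h1 := cubeScale_mul_hammingDist_le p.vertex q.vertex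
  have h2 : 2 * ((n : ℝ) + 1) * starDist p q ≤ 4 * ((n : ℝ) + 1) ^ 2 := by
    have h3 := mul_le_mul_of_nonneg_left (starDist_le_two p q)
      (by positivity : 0 ≤ 2 * ((n : ℝ) + 1))
    nlinarith [(Nat.cast_nonneg n : (0 : ℝ) ≤ n)]
  have h4 := mul_le_mul_of_nonneg_left h2 (cubeScale_pos n).le
  linarith

/-- The blocks indexed by `some n`, and a single point indexed by `none`. -/
def PointedBlock : Option ℕ → Type
  | none => Unit
  | some n => CubeBlock n

instance : (i : Option ℕ) → Finite (PointedBlock i)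
  | none => inferInstanceAs (Finite Unit)
  | some n => inferInstanceAs (Finite (CubeBlock n))

noncomputable instance : (i : Option ℕ) → MetricSpace (PointedBlock i)
  | none => inferInstanceAs (MetricSpace Unit)
  | some n => inferInstanceAs (MetricSpace (CubeBlock n))

/-- A bound for the diameter of `PointedBlock i`. -/
noncomputable def blockHeight : Option ℕ → ℝ
  | none => 0
  | some n => ((n : ℝ) + 1)⁻¹

lemma blockHeight_some_pos (n : ℕ) : 0 < blockHeight (some n) :=
  inv_pos.2 n.cast_add_one_pos

/-- The disjoint union of the blocks, compactified by a point. -/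
def CubeSequence : Type := Σ i, PointedBlock i

instance : Countable CubeSequence := inferInstanceAs (Countable (Σ i, PointedBlock i))

noncomputable instance : MetricSpace CubeSequence :=
  sigmaMaxMetricSpace blockHeight
    (fun i => match i with
      | none => fun _ _ => (dist_self (α := Unit) ()).le
      | some _ => CubeBlock.dist_le)
    (fun i j hij => by
      cases i with
      | some n => exact lt_max_of_lt_left (blockHeight_some_pos n)
      | none => cases j with
        | some n => exact lt_max_of_lt_right (blockHeight_some_pos n)
        | none => exact absurd rfl hij)

namespace CubeSequence

/-- The limit point of the blocks. -/
def limit : CubeSequence := ⟨none, ()⟩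

/-- The inclusion of the `n`-th block. -/
def ofBlock (n : ℕ) (p : CubeBlock n) : CubeSequence := ⟨some n, p⟩

lemma eq_limit_or_ofBlock (p : CubeSequence) : p = limit ∨ ∃ n x, p = ofBlock n x := by
  obtain ⟨_ | n, x⟩ := p
  · exact Or.inl rfl
  · exact Or.inr ⟨n, x, rfl⟩

lemma dist_ofBlock {n : ℕ} (p q : CubeBlock n) : dist (ofBlock n p) (ofBlock n q) = dist p q :=
  sigmaMaxDist_same (B := PointedBlock) (some n) p q

lemma dist_of_fst_ne {p q : CubeSequence} (h : p.1 ≠ q.1) :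
    dist p q = max (blockHeight p.1) (blockHeight q.1) :=
  sigmaMaxDist_of_ne h p.2 q.2

lemma finite_fst_preimage {s : Set (Option ℕ)} (hs : s.Finite) :
    {p : CubeSequence | p.1 ∈ s}.Finite := by
  refine (hs.biUnion fun i _ => Set.finite_range (fun x : PointedBlock i =>
    (⟨i, x⟩ : CubeSequence))).subset fun p hp => ?_
  exact Set.mem_biUnion (x := p.1) hp ⟨p.2, rfl⟩

instance : CompactSpace CubeSequence := by
  refine compactSpace_of_finite_compl_nhds limit fun s hs => ?_
  obtain ⟨ε, hε, hs⟩ := Metric.mem_nhds_iff.1 hs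
  obtain ⟨N, hN⟩ := exists_nat_one_div_lt hε
  refine (finite_fst_preimage ((Set.finite_lt_nat N).image some)).subset fun p hp => ?_
  obtain rfl | ⟨n, x, rfl⟩ := eq_limit_or_ofBlock p
  · exact absurd (hs (Metric.mem_ball_self hε)) hp
  · refine ⟨n, show n < N from not_le.1 fun hNn => hp (hs ?_), rfl⟩
    have hne : (ofBlock n x).1 ≠ limit.1 := Option.some_ne_none n
    rw [Metric.mem_ball, dist_of_fst_ne hne]
    change max ((n : ℝ) + 1)⁻¹ 0 < ε
    refine max_lt (lt_of_le_of_lt ?_ hN) hε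
    rw [← one_div]
    exact one_div_le_one_div_of_le N.cast_add_one_pos (by exact_mod_cast Nat.succ_le_succ hNn)

instance : TotallyDisconnectedSpace CubeSequence :=
  ⟨(Set.to_countable (univ : Set CubeSequence)).isTotallyDisconnected⟩

lemma isOpen_singleton_ofBlock {n : ℕ} (x : CubeBlock n) : IsOpen {ofBlock n x} := by
  refine isOpen_singleton_of_finite_mem_nhds _
    (Metric.ball_mem_nhds _ (blockHeight_some_pos n))
    ((finite_fst_preimage (Set.finite_singleton (some n))).subset fun p hp => ?_)
  by_contra hne
  replace hne : p.1 ≠ (ofBlock n x).1 := hne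
  rw [Metric.mem_ball, dist_of_fst_ne hne] at hp
  exact (le_max_right _ _).not_gt hp

/-- The set of all terminals, together with the limit point. -/
def terminals : Set CubeSequence :=
  {p | ∀ n x, p ≠ ofBlock n ⟨x, false⟩}

lemma ofBlock_mem_terminals {n : ℕ} {p : CubeBlock n} :
    ofBlock n p ∈ terminals ↔ p.isTerminal = true := by
  obtain ⟨x, a⟩ := p
  cases a with
  | false => simpa using fun h => h n x rfl
  | true =>
    refine iff_of_true (fun m y h => ?_) rfl
    obtain rfl : n = m := Option.some_injective _ (congrArg Sigma.fst h)
    have h1 : (⟨x, true⟩ : CubeBlock n) = ⟨y, false⟩ := eq_of_heq (Sigma.mk.inj h).2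
    exact Bool.true_eq_false.mp (congrArg CubeBlock.isTerminal h1)

lemma isClosed_terminals : IsClosed terminals := by
  have : terminalsᶜ = ⋃ (n) (x), {ofBlock n ⟨x, false⟩} := by
    ext p
    simp [terminals, eq_comm]
  rw [← isOpen_compl_iff, this]
  exact isOpen_iUnion fun n => isOpen_iUnion fun x => isOpen_singleton_ofBlock _

/-- The coordinates of the `n`-th cube, extended by zero to the other blocks. -/
noncomputable def coord (n : ℕ) (i : Fin (cubeDim n)) : CubeSequence → ℝ
  | ⟨none, _⟩ => 0
  | ⟨some m, x⟩ =>
    open Classical in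
    if h : n = m then (if CubeBlock.vertex x (Fin.cast (congrArg cubeDim h) i) then 1 else 0) else 0

lemma coord_ofBlock {n : ℕ} (i : Fin (cubeDim n)) (p : CubeBlock n) :
    coord n i (ofBlock n p) = if p.vertex i then 1 else 0 := by
  simp [coord, ofBlock]

lemma coord_of_fst_ne {n : ℕ} (i : Fin (cubeDim n)) {p : CubeSequence} (hp : p.1 ≠ some n) :
    coord n i p = 0 := by
  obtain ⟨_ | m, x⟩ := p
  · rfl
  · exact dif_neg fun h => hp (congrArg some h.symm)

lemma eq_ofBlock_of_fst_eq {n : ℕ} {p : CubeSequence} (hp : p.1 = some n) :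
    ∃ x, p = ofBlock n x := by
  obtain ⟨i, x⟩ := p
  obtain rfl : i = some n := hp
  exact ⟨x, rfl⟩

lemma abs_coord_sub_le_one {n : ℕ} (i : Fin (cubeDim n)) (p q : CubeSequence) :
    |coord n i p - coord n i q| ≤ 1 := by
  have h : ∀ p, 0 ≤ coord n i p ∧ coord n i p ≤ 1 := fun p => by
    by_cases hp : p.1 = some n
    · obtain ⟨x, rfl⟩ := eq_ofBlock_of_fst_eq hp
      rw [coord_ofBlock]
      split_ifs <;> norm_num
    · rw [coord_of_fst_ne i hp]
      norm_num
  rw [abs_sub_le_iff]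
  constructor <;> linarith [h p, h q]

lemma sum_abs_coord_sub {n : ℕ} (p q : CubeBlock n) :
    ∑ i, |coord n i (ofBlock n p) - coord n i (ofBlock n q)| = hammingDist p.vertex q.vertex := by
  simp only [coord_ofBlock, hammingDist, Finset.card_filter, Nat.cast_sum]
  refine Finset.sum_congr rfl fun i _ => ?_
  cases p.vertex i <;> cases q.vertex i <;> simp

/-- Distances from the `n`-th block to the rest of the space are large. -/
lemma cubeScale_mul_le_dist {n : ℕ} {p q : CubeSequence} (hpq : p.1 ≠ q.1)
    (h : p.1 = some n ∨ q.1 = some n) : cubeScale n * (20 * ((n : ℝ) + 1) ^ 2) ≤ dist p q := by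
  rw [cubeScale_mul, dist_of_fst_ne hpq]
  rcases h with h | h <;> rw [h]
  exacts [le_max_left (blockHeight (some n)) _, le_max_right _ (blockHeight (some n))]

lemma coord_lipschitz {n : ℕ} (i : Fin (cubeDim n)) {p q : CubeSequence} (hp : p ∈ terminals)
    (hq : q ∈ terminals) : cubeScale n * |coord n i p - coord n i q| ≤
      (2 * (2 * ((n : ℝ) + 1)))⁻¹ * dist p q := by
  have hn : (1 : ℝ) ≤ (n : ℝ) + 1 := by linarith [(Nat.cast_nonneg n : (0 : ℝ) ≤ n)]
  rw [inv_mul_eq_div, le_div_iff₀ (by positivity)]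
  have h0 := cubeScale_pos n
  have h1 : cubeScale n * |coord n i p - coord n i q| * (2 * (2 * ((n : ℝ) + 1))) ≤
      cubeScale n * (2 * (2 * ((n : ℝ) + 1))) := by
    have := mul_le_mul_of_nonneg_left (abs_coord_sub_le_one i p q) h0.le
    rw [mul_one] at this
    exact mul_le_mul_of_nonneg_right this (by positivity)
  by_cases h : p.1 = some n ∨ q.1 = some n
  · rcases eq_or_ne p.1 q.1 with hpq | hpq
    · obtain ⟨x, rfl⟩ := eq_ofBlock_of_fst_eq (h.elim id hpq.trans)
      obtain ⟨y, rfl⟩ := eq_ofBlock_of_fst_eq (h.elim hpq.symm.trans id)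
      rcases eq_or_ne x y with rfl | hxy
      · simp
      refine h1.trans ?_
      rw [dist_ofBlock, CubeBlock.dist_eq, starDist_of_ne (ofBlock_mem_terminals.1 hp)
        (ofBlock_mem_terminals.1 hq) hxy]
      refine mul_le_mul_of_nonneg_left ?_ h0.le
      linarith [(Nat.cast_nonneg _ : (0 : ℝ) ≤ hammingDist x.vertex y.vertex)]
    · refine h1.trans (le_trans (mul_le_mul_of_nonneg_left ?_ h0.le)
        (cubeScale_mul_le_dist hpq h))
      nlinarith
  · push Not at h
    rw [coord_of_fst_ne i h.1, coord_of_fst_ne i h.2]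
    simp

lemma sum_coord_le_dist {n : ℕ} (p q : CubeSequence) :
    ∑ i, cubeScale n * |coord n i p - coord n i q| ≤ dist p q := by
  have h0 := cubeScale_pos n
  rw [← Finset.mul_sum]
  by_cases h : p.1 = some n ∨ q.1 = some n
  · rcases eq_or_ne p.1 q.1 with hpq | hpq
    · obtain ⟨x, rfl⟩ := eq_ofBlock_of_fst_eq (h.elim id hpq.trans)
      obtain ⟨y, rfl⟩ := eq_ofBlock_of_fst_eq (h.elim hpq.symm.trans id)
      rw [dist_ofBlock, CubeBlock.dist_eq, sum_abs_coord_sub]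
      refine mul_le_mul_of_nonneg_left (le_add_of_nonneg_right ?_) h0.le
      exact mul_nonneg (by positivity) (starDist_nonneg x y)
    · refine le_trans (mul_le_mul_of_nonneg_left ?_ h0.le) (cubeScale_mul_le_dist hpq h)
      have h1 := Finset.sum_le_sum fun i (_ : i ∈ Finset.univ) =>
        abs_coord_sub_le_one (n := n) i p q
      rw [Finset.sum_const, Finset.card_univ, Fintype.card_fin, nsmul_eq_mul, mul_one,
        cast_cubeDim] at h1
      nlinarith [sq_nonneg ((n : ℝ) + 1)]
  · push Not at h
    simp only [coord_of_fst_ne _ h.1, coord_of_fst_ne _ h.2]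
    simp

lemma dist_vertex_terminal {n : ℕ} (x : Fin (cubeDim n) → Bool) :
    dist (ofBlock n ⟨x, false⟩) (ofBlock n ⟨x, true⟩) = 2 * ((n : ℝ) + 1) * cubeScale n := by
  rw [dist_ofBlock, CubeBlock.dist_eq]
  simp [starDist]
  ring

lemma dist_vertex_flipCoord_le {n : ℕ} (i : Fin (cubeDim n)) (x : Fin (cubeDim n) → Bool) :
    dist (ofBlock n ⟨x, false⟩) (ofBlock n ⟨flipCoord i x, false⟩) ≤ cubeScale n := by
  rw [dist_ofBlock, CubeBlock.dist_eq]
  have h1 : starDist (n := n) ⟨x, false⟩ ⟨flipCoord i x, false⟩ = 0 := by simp [starDist]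
  have h2 : hammingDist x (flipCoord i x) ≤ 1 := by
    refine (Finset.card_le_card fun j hj => ?_).trans_eq (Finset.card_singleton i)
    by_contra hji
    exact (Finset.mem_filter.1 hj).2
      (Function.update_of_ne (fun h => hji (Finset.mem_singleton.2 h)) _ _).symm
  have h3 : (hammingDist x (flipCoord i x) : ℝ) ≤ 1 := by exact_mod_cast h2
  rw [h1, mul_zero, add_zero]
  exact mul_le_of_le_one_right (cubeScale_pos n).le h3

end CubeSequence

/-- There exist a zero-dimensional compact metric space `X` and a closed subset `S ⊆ X`
admitting no continuous linear operator extending Lipschitz metrics. -/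
theorem nonexistence_of_linear_extension_operator_for_Lipschitz_metrics :
    ∃ (X : Type) (_ : MetricSpace X), CompactSpace X ∧ TotallyDisconnectedSpace X ∧
      ∃ S : Set X, IsClosed S ∧
        ¬ ∃ (u : (X → X → ℝ) → X → X → ℝ) (M : ℝ),
            IsMExtOp dist S univ u ∧ MOpNormLE dist S univ u M := by
  refine ⟨CubeSequence, inferInstance, inferInstance, inferInstance, CubeSequence.terminals,
    CubeSequence.isClosed_terminals, ?_⟩
  rintro ⟨u, M, hu, hM⟩
  obtain ⟨n, hn⟩ := exists_nat_ge M
  have hn0 : (0 : ℝ) ≤ n := n.cast_nonneg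
  have hM' : MOpNormLE dist CubeSequence.terminals univ u ((n : ℝ) + 1) :=
    fun ρ hρ hρ1 x hx y hy => (hM ρ hρ hρ1 x hx y hy).trans
      (mul_le_mul_of_nonneg_right (by linarith) dist_nonneg)
  have h := hu.le_of_cube hM' (by positivity) (by positivity : 0 < 2 * ((n : ℝ) + 1))
    (cubeScale_pos n) (by unfold cubeDim; positivity : 0 < cubeDim n)
    (fun x => CubeSequence.ofBlock n ⟨x, false⟩) (fun x => CubeSequence.ofBlock n ⟨x, true⟩)
    (CubeSequence.coord n) (fun x => CubeSequence.ofBlock_mem_terminals.2 rfl)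
    (fun i x => CubeSequence.coord_ofBlock i _)
    (fun x => (CubeSequence.dist_vertex_terminal x).le) CubeSequence.dist_vertex_flipCoord_le
    (fun i p hp q hq => CubeSequence.coord_lipschitz i hp hq)
    (fun p _ q _ => CubeSequence.sum_coord_le_dist p q)
  rw [cast_cubeDim] at h
  have h2 : 16 * ((n : ℝ) + 1) ^ 2 * ((n : ℝ) + 1) / (2 * (2 * ((n : ℝ) + 1))) =
      4 * ((n : ℝ) + 1) ^ 2 := by
    field_simp
    ring
  rw [h2] at h
  nlinarith
end

section
/- Let (X,d) be a compact metric space, S ⊆ X a closed subset, and p ∈ S. If there exists an extension operator for Lipschitz pseudometrics from S to X (an additive, positively homogeneous map u : PM_Lip(S) → PM_Lip(X) with u(ρ)|_{S×S} = ρ for all ρ and finite norm ‖u‖), then there exists a linear extension operator for Lipschitz functions from S to X with finite norm; in particular λ(S,X) < ∞ whenever Λ(S,X) < ∞. -/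
open Set

section Helpers

variable {X : Type*}

theorem isPseudometricOn_abs_sub (A : Set X) (θ : X → ℝ) :
    IsPseudometricOn A (fun x y => |θ x - θ y|) :=
  ⟨fun _ _ _ _ => abs_nonneg _, fun _ _ _ _ => abs_sub_comm _ _, fun _ _ => by simp,
    fun _ _ _ _ _ _ => abs_sub_le _ _ _⟩

theorem IsPseudometricOn.abs_sub_le {B : Set X} {ρ : X → X → ℝ} (h : IsPseudometricOn B ρ)
    {x y z : X} (hx : x ∈ B) (hy : y ∈ B) (hz : z ∈ B) : |ρ x z - ρ y z| ≤ ρ x y := by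
  obtain ⟨-, hs, -, ht⟩ := h
  rw [_root_.abs_sub_le_iff]
  exact ⟨by linarith [ht x hx y hy z hz], by linarith [ht y hy x hx z hz, hs x hx y hy]⟩

theorem IsPseudometricOn.add {A : Set X} {ρ₁ ρ₂ : X → X → ℝ} (h₁ : IsPseudometricOn A ρ₁)
    (h₂ : IsPseudometricOn A ρ₂) : IsPseudometricOn A (fun x y => ρ₁ x y + ρ₂ x y) := by
  obtain ⟨a₁, b₁, c₁, d₁⟩ := h₁
  obtain ⟨a₂, b₂, c₂, d₂⟩ := h₂
  refine ⟨fun x hx y hy => add_nonneg (a₁ x hx y hy) (a₂ x hx y hy), fun x hx y hy => ?_,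
    fun x hx => ?_, fun x hx y hy z hz => ?_⟩
  · simp only [b₁ x hx y hy, b₂ x hx y hy]
  · simp only [c₁ x hx, c₂ x hx, add_zero]
  · linarith [d₁ x hx y hy z hz, d₂ x hx y hy z hz]

theorem IsPseudometricOn.const_mul {A : Set X} {ρ : X → X → ℝ} (h : IsPseudometricOn A ρ)
    {c : ℝ} (hc : 0 ≤ c) : IsPseudometricOn A (fun x y => c * ρ x y) := by
  obtain ⟨a₁, b₁, c₁, d₁⟩ := h
  refine ⟨fun x hx y hy => mul_nonneg hc (a₁ x hx y hy), fun x hx y hy => ?_,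
    fun x hx => ?_, fun x hx y hy z hz => ?_⟩
  · simp only [b₁ x hx y hy]
  · simp only [c₁ x hx, mul_zero]
  · rw [← mul_add]
    exact mul_le_mul_of_nonneg_left (d₁ x hx y hy z hz) hc

/-- The function `t ↦ 2 B t - t ^ 2` is concave and increasing on `[0, B]`, so composing it with
the pseudometric `|θ x - θ y|` yields a pseudometric when `θ` has oscillation at most `B`. -/
theorem isPseudometricOn_two_mul_abs_sub_sq {A : Set X} {θ : X → ℝ} {B : ℝ}
    (hB : ∀ x ∈ A, ∀ y ∈ A, |θ x - θ y| ≤ B) :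
    IsPseudometricOn A (fun x y => 2 * B * |θ x - θ y| - (θ x - θ y) ^ 2) := by
  refine ⟨fun x hx y hy => ?_, fun x _ y _ => ?_, fun x _ => by simp, fun x hx y hy z hz => ?_⟩
  · have h := hB x hx y hy
    have h0 := abs_nonneg (θ x - θ y)
    dsimp only
    rw [← sq_abs]
    nlinarith
  · dsimp only
    rw [abs_sub_comm]
    ring
  · have h₁ := hB x hx y hy
    have h₂ := hB y hy z hz
    obtain ⟨a, ha⟩ : ∃ a, a = θ x - θ y := ⟨_, rfl⟩
    obtain ⟨b, hb⟩ : ∃ b, b = θ y - θ z := ⟨_, rfl⟩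
    have hab : θ x - θ z = a + b := by rw [ha, hb]; ring
    simp only [hab, ← ha, ← hb] at h₁ h₂ ⊢
    rcases abs_cases a with ⟨e₁, s₁⟩ | ⟨e₁, s₁⟩ <;> rcases abs_cases b with ⟨e₂, s₂⟩ | ⟨e₂, s₂⟩ <;>
      rcases abs_cases (a + b) with ⟨e₃, s₃⟩ | ⟨e₃, s₃⟩ <;> rw [e₁] at h₁ ⊢ <;>
      rw [e₂] at h₂ ⊢ <;> rw [e₃] <;> nlinarith

theorem isLipPM_of_pmNormLE [PseudoMetricSpace X] {A : Set X} {ρ : X → X → ℝ} {N : ℝ}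
    (h : IsPseudometricOn A ρ) (hN : PMNormLE dist A ρ N) : IsLipPM dist A ρ := by
  refine ⟨h, |N| + 1, by positivity, fun x hx y hy => (hN x hx y hy).trans ?_⟩
  exact mul_le_mul_of_nonneg_right ((le_abs_self N).trans (by linarith)) dist_nonneg

theorem PMNormLE.add {d ρ₁ ρ₂ : X → X → ℝ} {A : Set X} {N₁ N₂ : ℝ} (h₁ : PMNormLE d A ρ₁ N₁)
    (h₂ : PMNormLE d A ρ₂ N₂) : PMNormLE d A (fun x y => ρ₁ x y + ρ₂ x y) (N₁ + N₂) :=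
  fun x hx y hy => by rw [add_mul]; exact add_le_add (h₁ x hx y hy) (h₂ x hx y hy)

theorem PMNormLE.const_mul {d ρ : X → X → ℝ} {A : Set X} {N c : ℝ} (hc : 0 ≤ c)
    (h : PMNormLE d A ρ N) : PMNormLE d A (fun x y => c * ρ x y) (c * N) :=
  fun x hx y hy => by rw [mul_assoc]; exact mul_le_mul_of_nonneg_left (h x hx y hy) hc

theorem IsLipPM.add [PseudoMetricSpace X] {A : Set X} {ρ₁ ρ₂ : X → X → ℝ}
    (h₁ : IsLipPM dist A ρ₁) (h₂ : IsLipPM dist A ρ₂) :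
    IsLipPM dist A (fun x y => ρ₁ x y + ρ₂ x y) := by
  obtain ⟨p₁, C₁, _, n₁⟩ := h₁
  obtain ⟨p₂, C₂, _, n₂⟩ := h₂
  exact isLipPM_of_pmNormLE (p₁.add p₂) (n₁.add n₂)

theorem IsLipPM.const_mul [PseudoMetricSpace X] {A : Set X} {ρ : X → X → ℝ}
    (h : IsLipPM dist A ρ) {c : ℝ} (hc : 0 ≤ c) :
    IsLipPM dist A (fun x y => c * ρ x y) := by
  obtain ⟨p, C, _, n⟩ := h
  exact isLipPM_of_pmNormLE (p.const_mul hc) (n.const_mul hc)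

/-- `σ` is a difference of two pseudometrics on `A` whose Lipschitz norms are at most `N`. -/
def PMDiffLE (d : X → X → ℝ) (A : Set X) (σ : X → X → ℝ) (N : ℝ) : Prop :=
  ∃ ρ₁ ρ₂, IsLipPM d A ρ₁ ∧ IsLipPM d A ρ₂ ∧ PMNormLE d A ρ₁ N ∧ PMNormLE d A ρ₂ N ∧
    σ = fun x y => ρ₁ x y - ρ₂ x y

theorem PMDiffLE.add [PseudoMetricSpace X] {A : Set X} {σ₁ σ₂ : X → X → ℝ} {N₁ N₂ : ℝ}
    (h₁ : PMDiffLE dist A σ₁ N₁) (h₂ : PMDiffLE dist A σ₂ N₂) :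
    PMDiffLE dist A (fun x y => σ₁ x y + σ₂ x y) (N₁ + N₂) := by
  obtain ⟨ρ₁, ρ₂, a, b, na, nb, rfl⟩ := h₁
  obtain ⟨τ₁, τ₂, a', b', na', nb', rfl⟩ := h₂
  exact ⟨_, _, a.add a', b.add b', na.add na', nb.add nb', by funext x y; ring⟩

theorem PMDiffLE.neg {d : X → X → ℝ} {A : Set X} {σ : X → X → ℝ} {N : ℝ}
    (h : PMDiffLE d A σ N) : PMDiffLE d A (fun x y => -σ x y) N := by
  obtain ⟨ρ₁, ρ₂, a, b, na, nb, rfl⟩ := h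
  exact ⟨_, _, b, a, nb, na, by funext x y; ring⟩

theorem PMDiffLE.const_mul [PseudoMetricSpace X] {A : Set X} {σ : X → X → ℝ} {N c : ℝ}
    (hc : 0 ≤ c) (h : PMDiffLE dist A σ N) :
    PMDiffLE dist A (fun x y => c * σ x y) (c * N) := by
  obtain ⟨ρ₁, ρ₂, a, b, na, nb, rfl⟩ := h
  exact ⟨_, _, a.const_mul hc, b.const_mul hc, na.const_mul hc, nb.const_mul hc,
    by funext x y; ring⟩

/-- `θ` is bounded by `a` and Lipschitz with constant `L` on `A`. -/
def BddLip (d : X → X → ℝ) (A : Set X) (θ : X → ℝ) (a L : ℝ) : Prop :=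
  (∀ x ∈ A, |θ x| ≤ a) ∧ FunNormLE d A θ L

theorem BddLip.mono [PseudoMetricSpace X] {A : Set X} {θ : X → ℝ} {a L a' L' : ℝ}
    (h : BddLip dist A θ a L) (ha : a ≤ a') (hL : L ≤ L') : BddLip dist A θ a' L' :=
  ⟨fun x hx => (h.1 x hx).trans ha, fun x hx y hy =>
    (h.2 x hx y hy).trans (mul_le_mul_of_nonneg_right hL dist_nonneg)⟩

theorem BddLip.mul [PseudoMetricSpace X] {A : Set X} {θ η : X → ℝ} {a b K L : ℝ}
    (hθ : BddLip dist A θ a K) (hη : BddLip dist A η b L) :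
    BddLip dist A (fun x => θ x * η x) (a * b) (a * L + b * K) := by
  refine ⟨fun x hx => ?_, fun x hx y hy => ?_⟩
  · rw [abs_mul]
    exact mul_le_mul (hθ.1 x hx) (hη.1 x hx) (abs_nonneg _) ((abs_nonneg _).trans (hθ.1 x hx))
  · have e : θ x * η x - θ y * η y = θ x * (η x - η y) + η y * (θ x - θ y) := by ring
    rw [e]
    refine (abs_add_le _ _).trans ?_
    rw [abs_mul, abs_mul]
    have h₁ := mul_le_mul (hθ.1 x hx) (hη.2 x hx y hy) (abs_nonneg _)
      ((abs_nonneg _).trans (hθ.1 x hx))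
    have h₂ := mul_le_mul (hη.1 y hy) (hθ.2 x hx y hy) (abs_nonneg _)
      ((abs_nonneg _).trans (hη.1 y hy))
    linarith

theorem BddLip.add_mul [PseudoMetricSpace X] {A : Set X} {θ η : X → ℝ} {a b K L : ℝ}
    (hθ : BddLip dist A θ a K) (hη : BddLip dist A η b L) (c e : ℝ) :
    BddLip dist A (fun x => c * θ x + e * η x) (|c| * a + |e| * b) (|c| * K + |e| * L) := by
  refine ⟨fun x hx => ?_, fun x hx y hy => ?_⟩
  · refine (abs_add_le _ _).trans ?_
    rw [abs_mul, abs_mul]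
    exact add_le_add (mul_le_mul_of_nonneg_left (hθ.1 x hx) (abs_nonneg _))
      (mul_le_mul_of_nonneg_left (hη.1 x hx) (abs_nonneg _))
  · have e' : c * θ x + e * η x - (c * θ y + e * η y) =
        c * (θ x - θ y) + e * (η x - η y) := by ring
    rw [e']
    refine (abs_add_le _ _).trans ?_
    rw [abs_mul, abs_mul]
    have h₁ := mul_le_mul_of_nonneg_left (hθ.2 x hx y hy) (abs_nonneg c)
    have h₂ := mul_le_mul_of_nonneg_left (hη.2 x hx y hy) (abs_nonneg e)
    linarith

/-- The square of the increment of a bounded Lipschitz function, up to a multiple of the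
absolute value of the increment, is the opposite of a Lipschitz pseudometric. -/
theorem BddLip.pmDiffLE_sq [PseudoMetricSpace X] {A : Set X} {θ : X → ℝ} {a K : ℝ}
    (ha : 0 ≤ a) (hθ : BddLip dist A θ a K) :
    PMDiffLE dist A (fun x y => (θ x - θ y) ^ 2) (4 * a * K) := by
  have hosc : ∀ x ∈ A, ∀ y ∈ A, |θ x - θ y| ≤ 2 * a := fun x hx y hy =>
    (abs_sub _ _).trans (by linarith [hθ.1 x hx, hθ.1 y hy])
  have n₁ : PMNormLE dist A (fun x y => 2 * (2 * a) * |θ x - θ y|) (4 * a * K) :=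
    fun x hx y hy => by
      have := mul_le_mul_of_nonneg_left (hθ.2 x hx y hy) (show 0 ≤ 4 * a by positivity)
      dsimp only
      linarith
  have n₂ : PMNormLE dist A (fun x y => 2 * (2 * a) * |θ x - θ y| - (θ x - θ y) ^ 2)
      (4 * a * K) := fun x hx y hy =>
    (sub_le_self _ (sq_nonneg _)).trans (n₁ x hx y hy)
  exact ⟨_, _, isLipPM_of_pmNormLE ((isPseudometricOn_abs_sub A θ).const_mul (by positivity)) n₁,
    isLipPM_of_pmNormLE (isPseudometricOn_two_mul_abs_sub_sq hosc) n₂, n₁, n₂,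
    by funext x y; ring⟩

/-- Products of increments of bounded Lipschitz functions are differences of Lipschitz
pseudometrics, by polarization. -/
theorem BddLip.pmDiffLE_mul [PseudoMetricSpace X] {A : Set X} {θ η : X → ℝ} {a b T : ℝ}
    (ha : 0 < a) (hb : 0 < b) (hθ : BddLip dist A θ a (a / T)) (hη : BddLip dist A η b (b / T)) :
    PMDiffLE dist A (fun x y => (θ x - θ y) * (η x - η y)) (8 * (a * b) / T) := by
  have hp := ((hθ.add_mul hη b a).pmDiffLE_sq (by positivity)).const_mul
    (show 0 ≤ 1 / (4 * (a * b)) by positivity)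
  have hm := ((hθ.add_mul hη b (-a)).pmDiffLE_sq (by positivity)).const_mul
    (show 0 ≤ 1 / (4 * (a * b)) by positivity)
  convert hp.add hm.neg using 1
  · funext x y
    field_simp
    ring
  · rw [abs_neg, abs_of_pos ha, abs_of_pos hb]
    by_cases hT : T = 0
    · simp [hT]
    · field_simp
      ring

open Classical in
/-- The linear extension of `u` to differences of Lipschitz pseudometrics on `A`. -/
noncomputable def diffExt (d : X → X → ℝ) (A : Set X) (u : (X → X → ℝ) → X → X → ℝ)
    (σ : X → X → ℝ) : X → X → ℝ :=
  if h : ∃ ρ : (X → X → ℝ) × (X → X → ℝ), IsLipPM d A ρ.1 ∧ IsLipPM d A ρ.2 ∧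
      σ = fun x y => ρ.1 x y - ρ.2 x y then
    fun x y => u h.choose.1 x y - u h.choose.2 x y
  else 0

theorem diffExt_sub {d : X → X → ℝ} {A B : Set X} {u : (X → X → ℝ) → X → X → ℝ}
    (hu : IsPMExtOp d A B u) {ρ₁ ρ₂ : X → X → ℝ} (h₁ : IsLipPM d A ρ₁) (h₂ : IsLipPM d A ρ₂) :
    diffExt d A u (fun x y => ρ₁ x y - ρ₂ x y) = fun x y => u ρ₁ x y - u ρ₂ x y := by
  have h : ∃ ρ : (X → X → ℝ) × (X → X → ℝ), IsLipPM d A ρ.1 ∧ IsLipPM d A ρ.2 ∧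
      (fun x y => ρ₁ x y - ρ₂ x y) = fun x y => ρ.1 x y - ρ.2 x y := ⟨(ρ₁, ρ₂), h₁, h₂, rfl⟩
  rw [diffExt, dif_pos h]
  obtain ⟨k₁, k₂, e⟩ := h.choose_spec
  have e' : (fun x y => h.choose.1 x y + ρ₂ x y) = fun x y => ρ₁ x y + h.choose.2 x y := by
    funext x y
    have := congrFun (congrFun e x) y
    linarith
  have e'' := (hu.2.1 _ _ k₁ h₂).symm.trans ((congrArg u e').trans (hu.2.1 _ _ h₁ k₂))
  funext x y
  have := congrFun (congrFun e'' x) y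
  linarith

section Ext

variable [PseudoMetricSpace X] {A : Set X} {u : (X → X → ℝ) → X → X → ℝ}
  {σ σ₁ σ₂ : X → X → ℝ} {N N₁ N₂ : ℝ}

theorem diffExt_add {B : Set X} (hu : IsPMExtOp dist A B u) (h₁ : PMDiffLE dist A σ₁ N₁)
    (h₂ : PMDiffLE dist A σ₂ N₂) :
    diffExt dist A u (fun x y => σ₁ x y + σ₂ x y) =
      fun x y => diffExt dist A u σ₁ x y + diffExt dist A u σ₂ x y := by
  obtain ⟨ρ₁, ρ₂, a, b, -, -, rfl⟩ := h₁
  obtain ⟨τ₁, τ₂, a', b', -, -, rfl⟩ := h₂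
  rw [diffExt_sub hu a b, diffExt_sub hu a' b']
  have e : (fun x y => ρ₁ x y - ρ₂ x y + (τ₁ x y - τ₂ x y)) =
      fun x y => (ρ₁ x y + τ₁ x y) - (ρ₂ x y + τ₂ x y) := by
    funext x y
    ring
  rw [e, diffExt_sub hu (a.add a') (b.add b'), hu.2.1 _ _ a a', hu.2.1 _ _ b b']
  funext x y
  ring

theorem diffExt_neg {B : Set X} (hu : IsPMExtOp dist A B u) (h : PMDiffLE dist A σ N) :
    diffExt dist A u (fun x y => -σ x y) = fun x y => -diffExt dist A u σ x y := by
  obtain ⟨ρ₁, ρ₂, a, b, -, -, rfl⟩ := h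
  rw [diffExt_sub hu a b]
  simp only [neg_sub]
  rw [diffExt_sub hu b a]

theorem diffExt_const_mul {B : Set X} (hu : IsPMExtOp dist A B u) (h : PMDiffLE dist A σ N)
    (c : ℝ) :
    diffExt dist A u (fun x y => c * σ x y) = fun x y => c * diffExt dist A u σ x y := by
  have key : ∀ c : ℝ, 0 ≤ c →
      diffExt dist A u (fun x y => c * σ x y) = fun x y => c * diffExt dist A u σ x y := by
    intro c hc
    obtain ⟨ρ₁, ρ₂, a, b, -, -, rfl⟩ := h
    rw [diffExt_sub hu a b]
    simp only [mul_sub]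
    rw [diffExt_sub hu (a.const_mul hc) (b.const_mul hc), hu.2.2.1 c hc _ a, hu.2.2.1 c hc _ b]
  rcases le_total 0 c with hc | hc
  · exact key c hc
  · have e : (fun x y => c * σ x y) = fun x y => -((-c) * σ x y) := by
      funext x y
      ring
    rw [e, diffExt_neg hu (h.const_mul (neg_nonneg.2 hc)), key _ (neg_nonneg.2 hc)]
    funext x y
    ring

theorem diffExt_eq_of_mem {B : Set X} (hu : IsPMExtOp dist A B u) (h : PMDiffLE dist A σ N)
    {x y : X} (hx : x ∈ A) (hy : y ∈ A) : diffExt dist A u σ x y = σ x y := by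
  obtain ⟨ρ₁, ρ₂, a, b, -, -, rfl⟩ := h
  rw [diffExt_sub hu a b]
  simp only [hu.2.2.2 _ a x hx y hy, hu.2.2.2 _ b x hx y hy]

theorem PMOpNormLE.apply_le {B : Set X} {M : ℝ} (hM : PMOpNormLE dist A B u M)
    (hu : IsPMExtOp dist A B u) {ρ : X → X → ℝ} (hρ : IsLipPM dist A ρ) (hN : 0 < N)
    (hn : PMNormLE dist A ρ N) : PMNormLE dist B (u ρ) (N * |M|) := by
  intro x hx y hy
  have hN' : 0 ≤ N⁻¹ := by positivity
  have h := hM _ (hρ.const_mul hN')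
    (by simpa [inv_mul_cancel₀ hN.ne'] using hn.const_mul hN') x hx y hy
  rw [hu.2.2.1 _ hN' _ hρ, inv_mul_le_iff₀ hN] at h
  rw [mul_assoc]
  exact h.trans (mul_le_mul_of_nonneg_left
    (mul_le_mul_of_nonneg_right (le_abs_self M) dist_nonneg) hN.le)

theorem abs_diffExt_sub_le {B : Set X} {M : ℝ} (hM : PMOpNormLE dist A B u M)
    (hu : IsPMExtOp dist A B u) (hN : 0 < N) (h : PMDiffLE dist A σ N) {x y z : X}
    (hx : x ∈ B) (hy : y ∈ B) (hz : z ∈ B) :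
    |diffExt dist A u σ x z - diffExt dist A u σ y z| ≤ 2 * N * |M| * dist x y := by
  obtain ⟨ρ₁, ρ₂, a, b, na, nb, rfl⟩ := h
  rw [diffExt_sub hu a b]
  dsimp only
  have h₁ := (hu.1 _ a).1.abs_sub_le hx hy hz
  have h₂ := (hu.1 _ b).1.abs_sub_le hx hy hz
  have k₁ := hM.apply_le hu a hN na x hx y hy
  have k₂ := hM.apply_le hu b hN nb x hx y hy
  have e : u ρ₁ x z - u ρ₂ x z - (u ρ₁ y z - u ρ₂ y z) =
      (u ρ₁ x z - u ρ₁ y z) - (u ρ₂ x z - u ρ₂ y z) := by ring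
  rw [e]
  refine (abs_sub _ _).trans ?_
  linarith

end Ext

section Kernel

variable [PseudoMetricSpace X] {S : Set X} {p : X} {f : X → ℝ} {L t t' : ℝ}

theorem bddLip_inv_dist_add (S : Set X) (p : X) (ht : 0 < t) :
    BddLip dist S (fun x => (dist x p + t)⁻¹) t⁻¹ (t⁻¹ * t⁻¹) := by
  have hw : ∀ x, (dist x p + t)⁻¹ ≤ t⁻¹ := fun x =>
    inv_anti₀ ht (by linarith [dist_nonneg (x := x) (y := p)])
  have hpos : ∀ x, 0 < dist x p + t := fun x => by positivity
  refine ⟨fun x _ => ?_, fun x _ y _ => ?_⟩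
  · rw [abs_of_pos (inv_pos.2 (hpos x))]
    exact hw x
  · rw [inv_sub_inv (hpos x).ne' (hpos y).ne', abs_div, div_eq_mul_inv, mul_comm,
      abs_of_pos (mul_pos (hpos x) (hpos y)), mul_inv]
    refine mul_le_mul (mul_le_mul (hw x) (hw y) (inv_nonneg.2 (hpos y).le) (by positivity)) ?_
      (abs_nonneg _) (by positivity)
    have := abs_dist_sub_le y x p
    rwa [dist_comm y x, ← add_sub_add_right_eq_sub _ _ t] at this

theorem bddLip_dist_div (S : Set X) (p : X) (ht : 0 < t) :
    BddLip dist S (fun x => dist x p / (dist x p + t)) 1 (1 / t) := by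
  have hpos : ∀ x, 0 < dist x p + t := fun x => by positivity
  refine ⟨fun x _ => ?_, fun x hx y hy => ?_⟩
  · rw [abs_of_nonneg (div_nonneg dist_nonneg (hpos x).le), div_le_one (hpos x)]
    linarith
  · have h := (bddLip_inv_dist_add S p ht).2 x hx y hy
    have e : dist x p / (dist x p + t) - dist y p / (dist y p + t) =
        -(t * ((dist x p + t)⁻¹ - (dist y p + t)⁻¹)) := by
      have := (hpos x).ne'
      have := (hpos y).ne'
      field_simp
      ring
    rw [e, abs_neg, abs_mul, abs_of_pos ht]
    refine (mul_le_mul_of_nonneg_left h ht.le).trans (le_of_eq ?_)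
    field_simp

theorem bddLip_sub_div (hp : p ∈ S) (hL : 0 < L) (hf : FunNormLE dist S f L) (ht : 0 < t) :
    BddLip dist S (fun x => (f x - f p) / (dist x p + t)) L (2 * L / t) := by
  have hpos : ∀ x, 0 < dist x p + t := fun x => by positivity
  have hb : ∀ x ∈ S, |(f x - f p) / (dist x p + t)| ≤ L := fun x hx => by
    rw [abs_div, abs_of_pos (hpos x), div_le_iff₀ (hpos x)]
    exact (hf x hx p hp).trans (mul_le_mul_of_nonneg_left (by linarith) hL.le)
  refine ⟨hb, fun x hx y hy => ?_⟩
  have e : (f x - f p) / (dist x p + t) - (f y - f p) / (dist y p + t) =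
      (dist x p + t)⁻¹ * ((f x - f y) +
        (f y - f p) / (dist y p + t) * (dist y p - dist x p)) := by
    have := (hpos x).ne'
    have := (hpos y).ne'
    field_simp
    ring
  rw [e, abs_mul, abs_of_pos (inv_pos.2 (hpos x))]
  have h₁ : |(f x - f y) + (f y - f p) / (dist y p + t) * (dist y p - dist x p)| ≤
      2 * L * dist x y := by
    refine (abs_add_le _ _).trans ?_
    rw [abs_mul]
    have h₂ := abs_dist_sub_le y x p
    rw [dist_comm y x] at h₂
    have := mul_le_mul (hb y hy) h₂ (abs_nonneg _) hL.le
    linarith [hf x hx y hy]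
  have h₃ : (dist x p + t)⁻¹ ≤ t⁻¹ := inv_anti₀ ht (by linarith [dist_nonneg (x := x) (y := p)])
  refine (mul_le_mul h₃ h₁ (abs_nonneg _) (by positivity)).trans (le_of_eq ?_)
  field_simp

/-- A symmetric kernel, linear in `f`, whose value at `(x, p)` is `f x - f p` when
`dist x p = t`. -/
noncomputable def scaleKernel (p : X) (f : X → ℝ) (t : ℝ) (x y : X) : ℝ :=
  4 * t * (((f x - f p) / (dist x p + t) - (f y - f p) / (dist y p + t)) *
    (dist x p / (dist x p + t) - dist y p / (dist y p + t)))

theorem pmDiffLE_scaleKernel (hp : p ∈ S) (hL : 0 < L) (hf : FunNormLE dist S f L)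
    (ht : 0 ≤ t) : PMDiffLE dist S (scaleKernel p f t) (64 * L) := by
  rcases ht.eq_or_lt with rfl | ht
  · have n : PMNormLE dist S (fun _ _ => 0) (64 * L) := fun x _ y _ => by positivity
    have k : IsLipPM dist S (fun _ _ => 0) := isLipPM_of_pmNormLE
      ⟨by simp, by simp, by simp, by simp⟩ n
    exact ⟨_, _, k, k, n, n, by funext x y; simp [scaleKernel]⟩
  · convert (((bddLip_sub_div hp hL hf ht).mono (show L ≤ 2 * L by linarith)
      le_rfl).pmDiffLE_mul (by positivity) one_pos (bddLip_dist_div S p ht)).const_mul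
      (show 0 ≤ 4 * t by positivity) using 1
    · rfl
    · field_simp
      norm_num

theorem pmDiffLE_scaleKernel_sub (hp : p ∈ S) (hL : 0 < L) (hf : FunNormLE dist S f L)
    (ht : 0 < t) (htt' : t ≤ t') :
    PMDiffLE dist S (fun x y => scaleKernel p f t x y + -scaleKernel p f t' x y)
      (224 * L * (t' - t) / t) := by
  have ht' : 0 < t' := ht.trans_le htt'
  have hi : t'⁻¹ ≤ t⁻¹ := inv_anti₀ ht htt'
  have hi0 : 0 < t'⁻¹ := inv_pos.2 ht'
  have hg := bddLip_sub_div hp hL hf ht'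
  have hk := bddLip_dist_div S p ht
  have hw := bddLip_inv_dist_add S p ht'
  have hg' : BddLip dist S (fun x => (f x - f p) / (dist x p + t')) (2 * L) (2 * L / t) :=
    hg.mono (by linarith) (by gcongr)
  have hkw := (hk.mul hw).mono (a' := 2 * t'⁻¹) (L' := 2 * t'⁻¹ / t) (by linarith) (by
    rw [div_eq_mul_inv, div_eq_mul_inv]; nlinarith)
  have hgk := (hg.mul hk).mono (a' := 3 * L) (L' := 3 * L / t) (by linarith) (by
    simp only [div_eq_mul_inv]; nlinarith)
  have h₁ := ((hg'.pmDiffLE_mul (by positivity) (by positivity) hkw).const_mul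
    (show 0 ≤ 4 * (t' - t) * t' by nlinarith))
  have h₂ := ((hgk.pmDiffLE_mul (by positivity) one_pos hk).const_mul
    (show 0 ≤ 4 * (t' - t) by linarith)).neg
  convert h₁.add h₂ using 1
  · funext x y
    have hx : 0 ≤ dist x p := dist_nonneg
    have hy : 0 ≤ dist y p := dist_nonneg
    have := (show 0 < dist x p + t by positivity).ne'
    have := (show 0 < dist y p + t by positivity).ne'
    have := (show 0 < dist x p + t' by positivity).ne'
    have := (show 0 < dist y p + t' by positivity).ne'
    simp only [scaleKernel]
    field_simp
    ring
  · field_simp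
    ring

theorem scaleKernel_dist (p : X) (f : X → ℝ) {x : X} (hx : dist x p ≠ 0) :
    scaleKernel p f (dist x p) x p = f x - f p := by
  simp only [scaleKernel, dist_self]
  field_simp
  ring

theorem scaleKernel_self (p : X) (f : X → ℝ) (t : ℝ) (x : X) : scaleKernel p f t x x = 0 := by
  simp [scaleKernel]

end Kernel

/-- The extension of `f` obtained by applying `u` to the kernel at the scale `dist x p`. -/
noncomputable def funExt [PseudoMetricSpace X] (S : Set X) (p : X)
    (u : (X → X → ℝ) → X → X → ℝ) (f : X → ℝ) (x : X) : ℝ :=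
  f p + diffExt dist S u (scaleKernel p f (dist x p)) x p

theorem funNormLE_funExt [PseudoMetricSpace X] {S : Set X} {p : X} (hp : p ∈ S)
    {u : (X → X → ℝ) → X → X → ℝ} (hu : IsPMExtOp dist S univ u) {M : ℝ}
    (hM : PMOpNormLE dist S univ u M) {f : X → ℝ} {L : ℝ} (hL : 0 < L)
    (hf : FunNormLE dist S f L) :
    FunNormLE dist univ (funExt S p u f) (576 * |M| * L) := by
  have key : ∀ x y : X, dist x p ≤ dist y p →
      |funExt S p u f x - funExt S p u f y| ≤ 576 * |M| * L * dist x y := by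
    intro x y hxy
    have hK := fun t (ht : 0 ≤ t) => pmDiffLE_scaleKernel hp hL hf ht
    have hy := abs_diffExt_sub_le hM hu (by positivity) (hK (dist y p) dist_nonneg)
      (mem_univ x) (mem_univ y) (mem_univ p)
    have h0 : ∀ t, 0 ≤ t → diffExt dist S u (scaleKernel p f t) p p = 0 := fun t ht => by
      rw [diffExt_eq_of_mem hu (hK t ht) hp hp, scaleKernel_self]
    have hx : |diffExt dist S u (scaleKernel p f (dist x p)) x p -
        diffExt dist S u (scaleKernel p f (dist y p)) x p| ≤ 448 * |M| * L * dist x y := by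
      rcases hxy.eq_or_lt with h | h
      · rw [h, sub_self, abs_zero]
        positivity
      rcases (dist_nonneg (x := x) (y := p)).eq_or_lt with h' | h'
      · have a₁ := abs_diffExt_sub_le hM hu (by positivity) (hK (dist x p) dist_nonneg)
          (mem_univ x) (mem_univ p) (mem_univ p)
        have a₂ := abs_diffExt_sub_le hM hu (by positivity) (hK (dist y p) dist_nonneg)
          (mem_univ x) (mem_univ p) (mem_univ p)
        rw [h0 _ dist_nonneg, ← h', mul_zero, sub_zero] at a₁ a₂
        rw [← h', abs_nonpos_iff.1 a₁, abs_nonpos_iff.1 a₂, sub_self, abs_zero]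
        positivity
      · have hd := pmDiffLE_scaleKernel_sub hp hL hf h' hxy
        have a := abs_diffExt_sub_le hM hu (by
            have := sub_pos.2 h
            positivity) hd (mem_univ x) (mem_univ p) (mem_univ p)
        rw [diffExt_add hu (hK _ dist_nonneg) (hK _ dist_nonneg).neg,
          diffExt_neg hu (hK _ dist_nonneg)] at a
        dsimp only at a
        rw [h0 _ dist_nonneg, h0 _ dist_nonneg, neg_zero, add_zero, sub_zero,
          ← sub_eq_add_neg] at a
        refine a.trans ?_
        have e : 2 * (224 * L * (dist y p - dist x p) / dist x p) * |M| * dist x p =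
            448 * |M| * L * (dist y p - dist x p) := by
          field_simp
          ring
        rw [e]
        have := abs_dist_sub_le y x p
        rw [dist_comm y x] at this
        exact mul_le_mul_of_nonneg_left ((le_abs_self _).trans this) (by positivity)
    have e : funExt S p u f x - funExt S p u f y =
        (diffExt dist S u (scaleKernel p f (dist x p)) x p -
          diffExt dist S u (scaleKernel p f (dist y p)) x p) +
        (diffExt dist S u (scaleKernel p f (dist y p)) x p -
          diffExt dist S u (scaleKernel p f (dist y p)) y p) := by
      simp only [funExt]
      ring
    rw [e]
    refine (abs_add_le _ _).trans ?_
    linarith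
  intro x _ y _
  rcases le_total (dist x p) (dist y p) with h | h
  · exact key x y h
  · rw [abs_sub_comm, dist_comm]
    exact key y x h

theorem isFunExtOp_funExt [MetricSpace X] {S : Set X} {p : X} (hp : p ∈ S)
    {u : (X → X → ℝ) → X → X → ℝ} (hu : IsPMExtOp dist S univ u) {M : ℝ}
    (hM : PMOpNormLE dist S univ u M) : IsFunExtOp dist S univ (funExt S p u) := by
  refine ⟨?_, ?_, ?_, ?_⟩
  · rintro f ⟨L, hL, hf⟩
    refine ⟨576 * |M| * L + 1, by positivity, fun x hx y hy => ?_⟩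
    refine (funNormLE_funExt hp hu hM hL hf x hx y hy).trans ?_
    exact mul_le_mul_of_nonneg_right (by linarith) dist_nonneg
  · rintro f g ⟨L, hL, hf⟩ ⟨K, hK, hg⟩
    funext x
    have e : scaleKernel p (fun x => f x + g x) (dist x p) = fun y z =>
        scaleKernel p f (dist x p) y z + scaleKernel p g (dist x p) y z := by
      funext y z
      simp only [scaleKernel]
      ring
    simp only [funExt]
    rw [e, diffExt_add hu (pmDiffLE_scaleKernel hp hL hf dist_nonneg)
      (pmDiffLE_scaleKernel hp hK hg dist_nonneg)]
    ring
  · rintro c f ⟨L, hL, hf⟩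
    funext x
    have e : scaleKernel p (fun x => c * f x) (dist x p) = fun y z =>
        c * scaleKernel p f (dist x p) y z := by
      funext y z
      simp only [scaleKernel]
      ring
    simp only [funExt]
    rw [e, diffExt_const_mul hu (pmDiffLE_scaleKernel hp hL hf dist_nonneg)]
    ring
  · rintro f ⟨L, hL, hf⟩ x hx
    rw [funExt, diffExt_eq_of_mem hu (pmDiffLE_scaleKernel hp hL hf dist_nonneg) hx hp]
    rcases eq_or_ne x p with rfl | h
    · rw [scaleKernel_self, add_zero]
    · rw [scaleKernel_dist p f (dist_ne_zero.2 h)]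
      ring

end Helpers

/-- If there is an extension operator for Lipschitz pseudometrics from `S` to `X` with
finite norm, then there is a linear extension operator for Lipschitz functions from `S`
to `X` with finite norm; in particular `λ(S,X) < ∞` whenever `Λ(S,X) < ∞`. -/
theorem fun_ext_op_of_pm_ext_op {X : Type*} [MetricSpace X] [CompactSpace X]
    (S : Set X) (hS : IsClosed S) (p : X) (hp : p ∈ S)
    (h : ∃ (u : (X → X → ℝ) → X → X → ℝ) (M : ℝ),
        IsPMExtOp dist S univ u ∧ PMOpNormLE dist S univ u M) :
    ∃ (v : (X → ℝ) → X → ℝ) (M : ℝ),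
        IsFunExtOp dist S univ v ∧ FunOpNormLE dist S univ v M := by
  obtain ⟨u, M, hu, hM⟩ := h
  exact ⟨funExt S p u, 576 * |M| * 1, isFunExtOp_funExt hp hu hM,
    fun f _ hf => funNormLE_funExt hp hu hM one_pos hf⟩
end
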